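/- Solution of the discrete mean-variance hedging problem: under Assumptions A and B, let H = f(S_N) with real discrete FS decomposition H = H_0 + Σ_{k=1}^N ξ^H_k ΔS_k + L^H_N and intermediate value process H_n = H_0 + Σ_{k=1}^n ξ^H_k ΔS_k + L^H_n. Then the minimization of E[(H − V_0 − Σ_{k=1}^N v_k ΔS_k)²] over V_0 ∈ ℝ and v ∈ Θ is solved by V_0* = H_0 and the strategy φ* determined recursively by φ*_n = ξ^H_n + λ_n ( H_{n−1} − H_0 − Σ_{i=1}^{n−1} φ*_i ΔS_i ), where λ_n = (1/S_{n−1}) · (m(1,n) − 1)/(m(2,n) − 2m(1,n) + 1) for n = 1,…,N; moreover this solution is unique up to a null set. -/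

import Mathlib

open MeasureTheory ProbabilityTheory

lemma indepFun_comp_of_indep {Ω E F : Type*} {𝓖 m0 : MeasurableSpace Ω} {P : Measure Ω}
    [MeasurableSpace E] [MeasurableSpace F] {D : Ω → ℝ}
    (hind : Indep 𝓖 (MeasurableSpace.comap D inferInstance) P)
    {f : Ω → E} (hf : Measurable[𝓖] f) {ψ : ℝ → F} (hψ : Measurable ψ) :
    IndepFun f (fun ω => ψ (D ω)) P := by
  rw [IndepFun_iff_Indep]
  refine indep_of_indep_of_le_left (indep_of_indep_of_le_right hind ?_) hf.comap_le
  rintro _ ⟨s, hs, rfl⟩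
  exact ⟨ψ ⁻¹' s, hψ hs, rfl⟩

/-- Products of square-integrable `𝓖`-measurable variables with square-integrable variables
independent of `𝓖` are square-integrable. -/
lemma memLp_two_mul_of_indep {Ω : Type*} {m0 : MeasurableSpace Ω} {P : Measure Ω}
    {u R : Ω → ℝ} (hind : IndepFun u R P) (hu : MemLp u 2 P) (hR : MemLp R 2 P) :
    MemLp (fun ω => u ω * R ω) 2 P := by
  refine (memLp_two_iff_integrable_sq (hu.1.mul hR.1)).2 ?_
  have h2 : IndepFun (fun ω => u ω ^ 2) (fun ω => R ω ^ 2) P :=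
    hind.comp (measurable_id.pow_const 2) (measurable_id.pow_const 2)
  simpa only [Pi.mul_apply, mul_pow] using! h2.integrable_mul hu.integrable_sq hR.integrable_sq

lemma memLp_two_of_mul_of_indep {Ω : Type*} {m0 : MeasurableSpace Ω} {P : Measure Ω}
    {u R : Ω → ℝ} (hind : IndepFun u R P) (hu : AEStronglyMeasurable u P)
    (hR : MemLp R 2 P) (hpos : 0 < ∫ ω, R ω ^ 2 ∂P)
    (huR : MemLp (fun ω => u ω * R ω) 2 P) :
    MemLp u 2 P := by
  rw [memLp_two_iff_integrable_sq hu]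
  have h2 : IndepFun (fun ω => u ω ^ 2) (fun ω => R ω ^ 2) P :=
    hind.comp (measurable_id.pow_const 2) (measurable_id.pow_const 2)
  refine h2.integrable_left_of_integrable_op (· * ·) 1 one_ne_zero
    (fun x y => by simp [enorm_mul]) ?_ (hu.pow 2) (hR.1.pow 2) ?_
  · refine huR.integrable_sq.congr (.of_forall fun ω => ?_)
    simp [mul_pow]
  · intro h0
    rw [integral_congr_ae h0] at hpos
    simp at hpos

/-- Completing the square in one trading period. -/
lemma integral_sq_one_period {Ω : Type*} {m0 : MeasurableSpace Ω} {P : Measure Ω}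
    [IsProbabilityMeasure P] {e u l R : Ω → ℝ}
    (hind : IndepFun (fun ω => (e ω, u ω)) R P)
    (he : MemLp e 2 P) (hu : MemLp u 2 P) (hR : MemLp R 2 P) (hl : MemLp l 2 P)
    (hpos : 0 < ∫ ω, R ω ^ 2 ∂P)
    (hel : ∫ ω, e ω * l ω ∂P = 0) (hul : ∫ ω, u ω * R ω * l ω ∂P = 0) :
    ∫ ω, (e ω - u ω * R ω + l ω) ^ 2 ∂P =
      (∫ ω, R ω ^ 2 ∂P) *
          ∫ ω, (u ω - (∫ ω, R ω ∂P) / (∫ ω, R ω ^ 2 ∂P) * e ω) ^ 2 ∂P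
        + (1 - (∫ ω, R ω ∂P) ^ 2 / ∫ ω, R ω ^ 2 ∂P) * ∫ ω, e ω ^ 2 ∂P
        + ∫ ω, l ω ^ 2 ∂P := by
  set a := ∫ ω, R ω ∂P
  set b := ∫ ω, R ω ^ 2 ∂P with hb
  have hue : Integrable (fun ω => u ω * e ω) P := hu.integrable_mul he
  have huR : MemLp (fun ω => u ω * R ω) 2 P :=
    memLp_two_mul_of_indep (hind.comp measurable_snd measurable_id) hu hR
  have hueR : Integrable (fun ω => e ω * (u ω * R ω)) P := he.integrable_mul huR
  have hI1 : ∫ ω, e ω * (u ω * R ω) ∂P = (∫ ω, u ω * e ω ∂P) * a := by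
    have hi : IndepFun (fun ω => u ω * e ω) R P :=
      hind.comp (φ := fun p : ℝ × ℝ => p.2 * p.1) (measurable_snd.mul measurable_fst)
        measurable_id
    rw [← hi.integral_fun_mul_eq_mul_integral hue.1 hR.1]
    congr 1 with ω; ring
  have hI2 : ∫ ω, (u ω * R ω) ^ 2 ∂P = (∫ ω, u ω ^ 2 ∂P) * b := by
    have hi : IndepFun (fun ω => u ω ^ 2) (fun ω => R ω ^ 2) P :=
      hind.comp (φ := fun p : ℝ × ℝ => p.2 ^ 2) (measurable_snd.pow_const 2)
        (measurable_id.pow_const 2)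
    rw [hb, ← hi.integral_fun_mul_eq_mul_integral (hu.1.pow 2) (hR.1.pow 2)]
    congr 1 with ω; ring
  have hL : ∫ ω, (e ω - u ω * R ω + l ω) ^ 2 ∂P =
      ∫ ω, e ω ^ 2 ∂P - 2 * ∫ ω, e ω * (u ω * R ω) ∂P + ∫ ω, (u ω * R ω) ^ 2 ∂P
        + 2 * ∫ ω, e ω * l ω ∂P - 2 * ∫ ω, u ω * R ω * l ω ∂P + ∫ ω, l ω ^ 2 ∂P := by
    have h1 := he.integrable_sq
    have h2 := hueR.const_mul 2
    have h3 := huR.integrable_sq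
    have h4 : Integrable (fun ω => 2 * (e ω * l ω)) P := (he.integrable_mul hl).const_mul 2
    have h5 : Integrable (fun ω => 2 * (u ω * R ω * l ω)) P :=
      (huR.integrable_mul hl).const_mul 2
    have h6 := hl.integrable_sq
    simp only [← integral_const_mul]
    rw [← integral_sub h1 h2, ← integral_add (by fun_prop) h3, ← integral_add (by fun_prop) h4,
      ← integral_sub (by fun_prop) h5, ← integral_add (by fun_prop) h6]
    congr 1 with ω
    ring
  have hQ : ∫ ω, (u ω - a / b * e ω) ^ 2 ∂P =
      ∫ ω, u ω ^ 2 ∂P - 2 * (a / b) * ∫ ω, u ω * e ω ∂P + (a / b) ^ 2 * ∫ ω, e ω ^ 2 ∂P := by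
    have h1 := hu.integrable_sq
    have h2 := hue.const_mul (2 * (a / b))
    have h3 := he.integrable_sq.const_mul ((a / b) ^ 2)
    simp only [← integral_const_mul]
    rw [← integral_sub h1 h2, ← integral_add (by fun_prop) h3]
    congr 1 with ω
    ring
  rw [hL, hQ, hI1, hI2, hel, hul]
  field_simp
  ring

/-- A square-integrable value process `G` with increments `G (n+1) - G n = x (n+1) R (n+1) + l`,
where the residual `l` is orthogonal to every `𝓕 n`-measurable multiple of `1` and of the
return `R (n+1)`, and the returns are square-integrable, nonconstant and independent of the past. -/
structure IsResidualDecomposition {Ω : Type*} {m0 : MeasurableSpace Ω} (P : Measure Ω)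
    (𝓕 : Filtration ℕ m0) (N : ℕ) (R G x : ℕ → Ω → ℝ) : Prop where
  measG : ∀ n ≤ N, StronglyMeasurable[𝓕 n] (G n)
  memG : ∀ n ≤ N, MemLp (G n) 2 P
  measx : ∀ n < N, StronglyMeasurable[𝓕 n] (x (n + 1))
  memx : ∀ n < N, MemLp (x (n + 1)) 2 P
  measR : ∀ n < N, StronglyMeasurable[𝓕 (n + 1)] (R (n + 1))
  memR : ∀ n < N, MemLp (R (n + 1)) 2 P
  indepR : ∀ n < N, Indep (𝓕 n) (MeasurableSpace.comap (R (n + 1)) inferInstance) P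
  variance_pos : ∀ n < N, (∫ ω, R (n + 1) ω ∂P) ^ 2 < ∫ ω, R (n + 1) ω ^ 2 ∂P
  orthogonal : ∀ n < N, ∀ y : Ω → ℝ, StronglyMeasurable[𝓕 n] y → MemLp y 2 P →
    ∫ ω, y ω * (G (n + 1) ω - G n ω - x (n + 1) ω * R (n + 1) ω) ∂P = 0 ∧
    ∫ ω, y ω * R (n + 1) ω * (G (n + 1) ω - G n ω - x (n + 1) ω * R (n + 1) ω) ∂P = 0

/-- The hedging error at time `n` of the strategy with initial capital `V` and invested
amounts `u`. -/
def hedgingError {Ω : Type*} (R G : ℕ → Ω → ℝ) (V : ℝ) (u : ℕ → Ω → ℝ) (n : ℕ) (ω : Ω) : ℝ :=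
  G n ω - V - ∑ k ∈ Finset.Icc 1 n, u k ω * R k ω

namespace IsResidualDecomposition

variable {Ω : Type*} {m0 : MeasurableSpace Ω} {P : Measure Ω}
  {𝓕 : Filtration ℕ m0} {N : ℕ} {R G x : ℕ → Ω → ℝ}

lemma integral_sq_pos (hM : IsResidualDecomposition P 𝓕 N R G x) {n : ℕ} (hn : n < N) :
    0 < ∫ ω, R (n + 1) ω ^ 2 ∂P :=
  (sq_nonneg _).trans_lt (hM.variance_pos n hn)

lemma indepFun (hM : IsResidualDecomposition P 𝓕 N R G x) {n : ℕ} (hn : n < N)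
    {E : Type*} [MeasurableSpace E] {y : Ω → E} (hy : Measurable[𝓕 n] y) :
    IndepFun y (R (n + 1)) P :=
  indepFun_comp_of_indep (hM.indepR n hn) hy measurable_id

lemma stronglyMeasurable_hedgingError (hM : IsResidualDecomposition P 𝓕 N R G x) (V : ℝ)
    {u : ℕ → Ω → ℝ} {n : ℕ} (hn : n ≤ N)
    (hu : ∀ k < n, StronglyMeasurable[𝓕 k] (u (k + 1))) :
    StronglyMeasurable[𝓕 n] (hedgingError R G V u n) := by
  refine ((hM.measG n hn).sub stronglyMeasurable_const).sub
    (Finset.stronglyMeasurable_fun_sum _ fun k hk => ?_)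
  obtain ⟨j, rfl⟩ : ∃ j, k = j + 1 := ⟨k - 1, by grind⟩
  have hj : j < n := by grind
  exact ((hu j hj).mono (𝓕.mono hj.le)).mul ((hM.measR j (by omega)).mono (𝓕.mono hj))

variable [IsProbabilityMeasure P]

lemma memLp_hedgingError (hM : IsResidualDecomposition P 𝓕 N R G x) (V : ℝ)
    {u : ℕ → Ω → ℝ} {n : ℕ} (hn : n ≤ N)
    (hu : ∀ k < n, StronglyMeasurable[𝓕 k] (u (k + 1)))
    (huL : ∀ k < n, MemLp (u (k + 1)) 2 P) :
    MemLp (hedgingError R G V u n) 2 P := by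
  refine ((hM.memG n hn).sub (memLp_const V)).sub (memLp_finsetSum _ fun k hk => ?_)
  obtain ⟨j, rfl⟩ : ∃ j, k = j + 1 := ⟨k - 1, by grind⟩
  have hj : j < n := by grind
  exact memLp_two_mul_of_indep (hM.indepFun (by omega) (hu j hj).measurable) (huL j hj)
    (hM.memR j (by omega))

lemma integral_sq_hedgingError_succ (hM : IsResidualDecomposition P 𝓕 N R G x) (V : ℝ)
    {u : ℕ → Ω → ℝ} {n : ℕ} (hn : n < N)
    (hu : ∀ k < n + 1, StronglyMeasurable[𝓕 k] (u (k + 1)))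
    (huL : ∀ k < n + 1, MemLp (u (k + 1)) 2 P) :
    ∫ ω, hedgingError R G V u (n + 1) ω ^ 2 ∂P =
      (∫ ω, R (n + 1) ω ^ 2 ∂P) *
          ∫ ω, (u (n + 1) ω - x (n + 1) ω - (∫ ω, R (n + 1) ω ∂P) /
            (∫ ω, R (n + 1) ω ^ 2 ∂P) * hedgingError R G V u n ω) ^ 2 ∂P
        + (1 - (∫ ω, R (n + 1) ω ∂P) ^ 2 / ∫ ω, R (n + 1) ω ^ 2 ∂P) *
          ∫ ω, hedgingError R G V u n ω ^ 2 ∂P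
        + ∫ ω, (G (n + 1) ω - G n ω - x (n + 1) ω * R (n + 1) ω) ^ 2 ∂P := by
  have hem := hM.stronglyMeasurable_hedgingError V hn.le (fun k hk => hu k (by omega))
  have heL := hM.memLp_hedgingError V hn.le (fun k hk => hu k (by omega))
    (fun k hk => huL k (by omega))
  have hum := (hu n (by omega)).sub (hM.measx n hn)
  have huL' := (huL n (by omega)).sub (hM.memx n hn)
  have hxR := memLp_two_mul_of_indep (hM.indepFun hn (hM.measx n hn).measurable)
    (hM.memx n hn) (hM.memR n hn)
  have key := integral_sq_one_period (hM.indepFun hn (hem.measurable.prodMk hum.measurable))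
    heL huL' (hM.memR n hn) (((hM.memG (n + 1) hn).sub (hM.memG n hn.le)).sub hxR)
    (hM.integral_sq_pos hn) (hM.orthogonal n hn _ hem heL).1 (hM.orthogonal n hn _ hum huL').2
  simp only [Pi.sub_apply] at key
  rw [← key]
  congr 1 with ω
  rw [hedgingError, hedgingError, Finset.sum_Icc_succ_top (by omega)]
  ring

variable {c : ℝ} {ψ : ℕ → Ω → ℝ}

/-- The feedback strategy is predictable with square-integrable invested amounts. -/
lemma feedback_admissible (hM : IsResidualDecomposition P 𝓕 N R G x)
    (hψ : ∀ n < N, ∀ ω, ψ (n + 1) ω = x (n + 1) ω + (∫ ω, R (n + 1) ω ∂P) /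
      (∫ ω, R (n + 1) ω ^ 2 ∂P) * hedgingError R G c ψ n ω) (n : ℕ) (hn : n < N) :
    StronglyMeasurable[𝓕 n] (ψ (n + 1)) ∧ MemLp (ψ (n + 1)) 2 P := by
  induction n using Nat.strong_induction_on with
  | _ n ih =>
    have h1 := hM.stronglyMeasurable_hedgingError (u := ψ) c hn.le
      (fun k hk => (ih k hk (by omega)).1)
    have h2 := hM.memLp_hedgingError (u := ψ) c hn.le (fun k hk => (ih k hk (by omega)).1)
      (fun k hk => (ih k hk (by omega)).2)
    rw [funext (hψ n hn)]
    exact ⟨(hM.measx n hn).add (h1.const_mul _), (hM.memx n hn).add (h2.const_mul _)⟩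

/-- The feedback strategy minimizes the mean squared hedging error, and it is the only
minimizer. -/
theorem feedback_optimal (hM : IsResidualDecomposition P 𝓕 N R G x) (hc : ∀ ω, G 0 ω = c)
    (hψ : ∀ n < N, ∀ ω, ψ (n + 1) ω = x (n + 1) ω + (∫ ω, R (n + 1) ω ∂P) /
      (∫ ω, R (n + 1) ω ^ 2 ∂P) * hedgingError R G c ψ n ω)
    (V : ℝ) {u : ℕ → Ω → ℝ} (hu : ∀ k < N, StronglyMeasurable[𝓕 k] (u (k + 1)))
    (huL : ∀ k < N, MemLp (u (k + 1)) 2 P) (n : ℕ) (hn : n ≤ N) :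
    ∫ ω, hedgingError R G c ψ n ω ^ 2 ∂P ≤ ∫ ω, hedgingError R G V u n ω ^ 2 ∂P ∧
    (∫ ω, hedgingError R G V u n ω ^ 2 ∂P = ∫ ω, hedgingError R G c ψ n ω ^ 2 ∂P →
      V = c ∧ ∀ k < n, u (k + 1) =ᵐ[P] ψ (k + 1)) := by
  induction n with
  | zero =>
    simp only [hedgingError, hc]
    simp only [sub_self, zero_lt_one, Finset.Icc_eq_empty_of_lt, Finset.sum_empty, sub_zero,
      integral_const, probReal_univ, smul_eq_mul, one_mul]
    refine ⟨by nlinarith [sq_nonneg (c - V)], fun h => ⟨?_, by simp⟩⟩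
    have : c - V = 0 := by simpa using h
    linarith
  | succ n ih =>
    have hn' : n < N := hn
    obtain ⟨hle, heq⟩ := ih hn'.le
    have hb := hM.integral_sq_pos hn'
    have hψa := hM.feedback_admissible hψ
    have hcpos : 0 < 1 - (∫ ω, R (n + 1) ω ∂P) ^ 2 / ∫ ω, R (n + 1) ω ^ 2 ∂P := by
      rw [sub_pos, div_lt_one hb]
      exact hM.variance_pos n hn'
    have hstepu := hM.integral_sq_hedgingError_succ V hn' (fun k hk => hu k (by omega))
      (fun k hk => huL k (by omega))
    have hstepψ := hM.integral_sq_hedgingError_succ c hn' (fun k hk => (hψa k (by omega)).1)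
      (fun k hk => (hψa k (by omega)).2)
    have hzero : ∫ ω, (ψ (n + 1) ω - x (n + 1) ω - (∫ ω, R (n + 1) ω ∂P) /
        (∫ ω, R (n + 1) ω ^ 2 ∂P) * hedgingError R G c ψ n ω) ^ 2 ∂P = 0 := by
      simp [hψ n hn']
    rw [hzero, mul_zero, zero_add] at hstepψ
    set q := fun ω => u (n + 1) ω - x (n + 1) ω - (∫ ω, R (n + 1) ω ∂P) /
        (∫ ω, R (n + 1) ω ^ 2 ∂P) * hedgingError R G V u n ω with hq
    have hqL : MemLp q 2 P := ((huL n hn').sub (hM.memx n hn')).sub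
      ((hM.memLp_hedgingError V hn'.le (fun k hk => hu k (by omega))
        (fun k hk => huL k (by omega))).const_mul _)
    have hq0 : 0 ≤ ∫ ω, q ω ^ 2 ∂P := integral_nonneg fun ω => sq_nonneg _
    have hbq := mul_nonneg hb.le hq0
    have hce := mul_le_mul_of_nonneg_left hle hcpos.le
    change _ = _ * (∫ ω, q ω ^ 2 ∂P) + _ + _ at hstepu
    refine ⟨by linarith, fun h => ?_⟩
    have hce' := le_antisymm (by linarith) hce
    have hbq' : (∫ ω, R (n + 1) ω ^ 2 ∂P) * ∫ ω, q ω ^ 2 ∂P = 0 := by linarith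
    obtain ⟨hV, hk⟩ := heq (mul_left_cancel₀ hcpos.ne' hce')
    refine ⟨hV, fun k hkn => ?_⟩
    rcases Nat.lt_succ_iff_lt_or_eq.1 hkn with h1 | rfl
    · exact hk k h1
    have hqz := (integral_eq_zero_iff_of_nonneg (fun ω => sq_nonneg (q ω))
      hqL.integrable_sq).1 ((mul_eq_zero.1 hbq').resolve_left hb.ne')
    have hall : ∀ᵐ ω ∂P, ∀ j, j < k → u (j + 1) ω = ψ (j + 1) ω :=
      ae_all_iff.2 fun j => by
        by_cases hj : j < k
        · filter_upwards [hk j hj] with ω hω _ using hω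
        · exact .of_forall fun ω h => absurd h hj
    filter_upwards [hqz, hall] with ω hω hj
    have herr : hedgingError R G V u k ω = hedgingError R G c ψ k ω := by
      rw [hedgingError, hedgingError, hV]
      congr 1
      refine Finset.sum_congr rfl fun i hi => ?_
      obtain ⟨j, rfl⟩ : ∃ j, i = j + 1 := ⟨i - 1, by grind⟩
      rw [hj j (by grind)]
    have hω' : q ω = 0 := by simpa using hω
    rw [hψ k hn', ← herr]
    simp only [hq] at hω'
    linarith

end IsResidualDecomposition

lemma rpow_le_rpow_add_rpow {s a b x : ℝ} (hs : 0 < s) (ha : a ≤ x) (hb : x ≤ b) :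
    s ^ x ≤ s ^ a + s ^ b := by
  rcases le_total 1 s with h | h
  · linarith [Real.rpow_le_rpow_of_exponent_le h hb, Real.rpow_pos_of_pos hs a]
  · linarith [Real.rpow_le_rpow_of_exponent_ge hs h ha, Real.rpow_pos_of_pos hs b]

lemma ofReal_exp_cpow (x : ℝ) (v : ℂ) : ((Real.exp x : ℝ) : ℂ) ^ v = Complex.exp (v * x) := by
  rw [Complex.cpow_def_of_ne_zero (by exact_mod_cast (Real.exp_pos x).ne'),
    ← Complex.ofReal_log (Real.exp_pos x).le, Real.log_exp, mul_comm]

/-- The superposition `∫ c(v) s^v w(v) μ(dv)` of power functions. -/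
noncomputable def powerIntegral (μ : Measure ℂ) (w c : ℂ → ℂ) (s : ℝ) : ℂ :=
  ∫ v, c v * (s : ℂ) ^ v * w v ∂μ

section PowerIntegral

variable {μ : Measure ℂ} {w c : ℂ → ℂ} {a b C : ℝ}

lemma measurable_powerIntegral [SFinite μ] (hw : AEStronglyMeasurable w μ) (hc : Measurable c) :
    Measurable (powerIntegral μ w c) := by
  have hcongr : powerIntegral μ w c = powerIntegral μ (hw.mk w) c := by
    funext s
    refine integral_congr_ae ?_
    filter_upwards [hw.ae_eq_mk] with v hv
    rw [hv]
  rw [hcongr]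
  have hwm := hw.stronglyMeasurable_mk.measurable
  have hk : Measurable fun p : ℝ × ℂ => c p.2 * (p.1 : ℂ) ^ p.2 * hw.mk w p.2 := by fun_prop
  exact hk.stronglyMeasurable.integral_prod_right.measurable

lemma norm_mul_cpow_mul_le {s : ℝ} (hs : 0 < s) {v : ℂ} (hv : a ≤ v.re ∧ v.re ≤ b ∧ ‖c v‖ ≤ C) :
    ‖c v * (s : ℂ) ^ v * w v‖ ≤ (s ^ a + s ^ b) * (C * ‖w v‖) := by
  rw [norm_mul, norm_mul, Complex.norm_cpow_eq_rpow_re_of_pos hs]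
  have h1 := rpow_le_rpow_add_rpow hs hv.1 hv.2.1
  have h2 : 0 < s ^ v.re := Real.rpow_pos_of_pos hs _
  have h3 := (norm_nonneg _).trans hv.2.2
  calc ‖c v‖ * s ^ v.re * ‖w v‖ ≤ C * (s ^ a + s ^ b) * ‖w v‖ := by
        gcongr
        exact hv.2.2
    _ = _ := by ring

lemma norm_powerIntegral_le (hw : Integrable w μ)
    (hc : ∀ᵐ v ∂μ, a ≤ v.re ∧ v.re ≤ b ∧ ‖c v‖ ≤ C) {s : ℝ} (hs : 0 < s) :
    ‖powerIntegral μ w c s‖ ≤ (s ^ a + s ^ b) * (C * ∫ v, ‖w v‖ ∂μ) := by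
  rw [← integral_const_mul, ← integral_const_mul]
  refine norm_integral_le_of_norm_le ((hw.norm.const_mul C).const_mul _) ?_
  filter_upwards [hc] with v hv
  exact norm_mul_cpow_mul_le hs hv

variable {Ω : Type*} {m0 : MeasurableSpace Ω} {P : Measure Ω}

lemma memLp_re_powerIntegral [SFinite μ] (hw : Integrable w μ) (hcm : Measurable c)
    (hc : ∀ᵐ v ∂μ, a ≤ v.re ∧ v.re ≤ b ∧ ‖c v‖ ≤ C) {S : Ω → ℝ} (hSm : Measurable S)
    (hSpos : ∀ ω, 0 < S ω) (hSa : MemLp (fun ω => S ω ^ a) 2 P)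
    (hSb : MemLp (fun ω => S ω ^ b) 2 P) :
    MemLp (fun ω => (powerIntegral μ w c (S ω)).re) 2 P := by
  have hm : Measurable fun ω => (powerIntegral μ w c (S ω)).re :=
    Complex.measurable_re.comp ((measurable_powerIntegral hw.1 hcm).comp hSm)
  refine ((hSa.add hSb).mul_const (C * ∫ v, ‖w v‖ ∂μ)).mono' hm.aestronglyMeasurable
    (.of_forall fun ω => ?_)
  exact (Complex.abs_re_le_norm _).trans (norm_powerIntegral_le hw hc (hSpos ω))

variable [SFinite P] [SFinite μ]

/-- Fubini's theorem for expectations of superpositions of powers. -/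
lemma integral_mul_powerIntegral (hw : Integrable w μ) (hcm : Measurable c)
    (hc : ∀ᵐ v ∂μ, a ≤ v.re ∧ v.re ≤ b ∧ ‖c v‖ ≤ C) {S Y : Ω → ℝ} (hSm : Measurable S)
    (hSpos : ∀ ω, 0 < S ω) (hYm : AEStronglyMeasurable Y P)
    (hY : Integrable (fun ω => Y ω * (S ω ^ a + S ω ^ b)) P) :
    Integrable (fun ω => (Y ω : ℂ) * powerIntegral μ w c (S ω)) P ∧
    Integrable (fun v => c v * (∫ ω, (Y ω : ℂ) * (S ω : ℂ) ^ v ∂P) * w v) μ ∧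
    ∫ ω, (Y ω : ℂ) * powerIntegral μ w c (S ω) ∂P =
      ∫ v, c v * (∫ ω, (Y ω : ℂ) * (S ω : ℂ) ^ v ∂P) * w v ∂μ := by
  have hYc : AEStronglyMeasurable (fun ω => (Y ω : ℂ)) P :=
    Complex.continuous_ofReal.comp_aestronglyMeasurable hYm
  have hint : Integrable (fun p : Ω × ℂ => (Y p.1 : ℂ) * (c p.2 * (S p.1 : ℂ) ^ p.2 * w p.2))
      (P.prod μ) := by
    refine (hY.norm.mul_prod (hw.norm.const_mul C)).mono' ?_ ?_
    · refine hYc.comp_fst.mul (AEStronglyMeasurable.mul ?_ hw.1.comp_snd)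
      have : Measurable fun p : Ω × ℂ => c p.2 * (S p.1 : ℂ) ^ p.2 := by fun_prop
      exact this.aestronglyMeasurable
    · filter_upwards [Measure.quasiMeasurePreserving_snd.ae hc] with p hp
      have h1 := norm_mul_cpow_mul_le (w := w) (hSpos p.1) hp
      have h2 : 0 < S p.1 ^ a + S p.1 ^ b :=
        add_pos (Real.rpow_pos_of_pos (hSpos _) _) (Real.rpow_pos_of_pos (hSpos _) _)
      rw [norm_mul, Complex.norm_real, norm_mul (Y p.1), Real.norm_of_nonneg h2.le, mul_assoc ‖Y p.1‖]
      exact mul_le_mul_of_nonneg_left h1 (norm_nonneg _)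
  have e1 : ∀ ω, ∫ v, (Y ω : ℂ) * (c v * (S ω : ℂ) ^ v * w v) ∂μ =
      (Y ω : ℂ) * powerIntegral μ w c (S ω) := fun ω => integral_const_mul _ _
  have e2 : ∀ v, ∫ ω, (Y ω : ℂ) * (c v * (S ω : ℂ) ^ v * w v) ∂P =
      c v * (∫ ω, (Y ω : ℂ) * (S ω : ℂ) ^ v ∂P) * w v := fun v => by
    rw [← integral_const_mul, ← integral_mul_const]
    congr 1 with ω
    ring
  refine ⟨?_, ?_, ?_⟩
  · simpa only [e1] using hint.integral_prod_left
  · simpa only [e2] using hint.integral_prod_right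
  · simp only [← e1, ← e2]
    exact integral_integral_swap hint

end PowerIntegral

/-- If the coefficients `c₁, c₀, cx` satisfy the linear relation obtained by testing one period
against `T = ψ(D)`, the residual of the superposed decomposition is orthogonal to `y T`. -/
lemma integral_mul_residual_eq_zero {Ω : Type*} {𝓖 m0 : MeasurableSpace Ω} {P : Measure Ω}
    [IsProbabilityMeasure P] {μ : Measure ℂ} [SFinite μ] {w c₁ c₀ cx : ℂ → ℂ} {a b C₁ C₀ Cx : ℝ}
    (h𝓖 : 𝓖 ≤ m0) {D S S' y : Ω → ℝ} (hD : Measurable D)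
    (hind : Indep 𝓖 (MeasurableSpace.comap D inferInstance) P)
    (hw : Integrable w μ)
    (hc₁m : Measurable c₁) (hc₁ : ∀ᵐ v ∂μ, a ≤ v.re ∧ v.re ≤ b ∧ ‖c₁ v‖ ≤ C₁)
    (hc₀m : Measurable c₀) (hc₀ : ∀ᵐ v ∂μ, a ≤ v.re ∧ v.re ≤ b ∧ ‖c₀ v‖ ≤ C₀)
    (hcxm : Measurable cx) (hcx : ∀ᵐ v ∂μ, a ≤ v.re ∧ v.re ≤ b ∧ ‖cx v‖ ≤ Cx)
    (hS : Measurable[𝓖] S) (hSpos : ∀ ω, 0 < S ω) (hS' : ∀ ω, S' ω = S ω * Real.exp (D ω))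
    (hSa : MemLp (fun ω => S ω ^ a) 2 P) (hSb : MemLp (fun ω => S ω ^ b) 2 P)
    (hS'a : MemLp (fun ω => S' ω ^ a) 2 P) (hS'b : MemLp (fun ω => S' ω ^ b) 2 P)
    (hR : MemLp (fun ω => Real.exp (D ω) - 1) 2 P)
    (hy : Measurable[𝓖] y) (hyL : MemLp y 2 P)
    {ψ : ℝ → ℝ} (hψ : Measurable ψ) (hψL : MemLp (fun ω => ψ (D ω)) 2 P)
    (hrel : ∀ᵐ v ∂μ, c₁ v * ∫ ω, (ψ (D ω) : ℂ) * Complex.exp (v * D ω) ∂P =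
      c₀ v * (∫ ω, ψ (D ω) ∂P : ℝ) +
        cx v * (∫ ω, ψ (D ω) * (Real.exp (D ω) - 1) ∂P : ℝ)) :
    ∫ ω, y ω * ψ (D ω) * ((powerIntegral μ w c₁ (S' ω)).re - (powerIntegral μ w c₀ (S ω)).re
      - (powerIntegral μ w cx (S ω)).re * (Real.exp (D ω) - 1)) ∂P = 0 := by
  have hSm : Measurable S := hS.mono h𝓖 le_rfl
  have hym : Measurable y := hy.mono h𝓖 le_rfl
  have hS'm : Measurable S' := by
    rw [funext hS']
    fun_prop
  have hS'pos : ∀ ω, 0 < S' ω := fun ω => by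
    rw [hS']
    exact mul_pos (hSpos ω) (Real.exp_pos _)
  have hyψ : MemLp (fun ω => y ω * ψ (D ω)) 2 P :=
    memLp_two_mul_of_indep (indepFun_comp_of_indep hind hy hψ) hyL hψL
  have hySab : Integrable (fun ω => y ω * (S ω ^ a + S ω ^ b)) P :=
    hyL.integrable_mul (hSa.add hSb)
  have hψR : Integrable (fun ω => ψ (D ω) * (Real.exp (D ω) - 1)) P := hψL.integrable_mul hR
  have hint3 : Integrable (fun ω => y ω * (ψ (D ω) * (Real.exp (D ω) - 1)) *
      (S ω ^ a + S ω ^ b)) P := by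
    have hi : IndepFun (fun ω => y ω * (S ω ^ a + S ω ^ b))
        (fun ω => ψ (D ω) * (Real.exp (D ω) - 1)) P :=
      indepFun_comp_of_indep (ψ := fun t => ψ t * (Real.exp t - 1)) hind
        (hy.mul ((hS.pow_const a).add (hS.pow_const b))) (by fun_prop)
    refine (hi.integrable_mul hySab hψR).congr (.of_forall fun ω => ?_)
    simp only [Pi.mul_apply]
    ring
  obtain ⟨i1, j1, k1⟩ := integral_mul_powerIntegral hw hc₁m hc₁ hS'm hS'pos
    (Y := fun ω => y ω * ψ (D ω)) hyψ.1
    (hyψ.integrable_mul (hS'a.add hS'b))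
  obtain ⟨i2, j2, k2⟩ := integral_mul_powerIntegral hw hc₀m hc₀ hSm hSpos
    (Y := fun ω => y ω * ψ (D ω)) hyψ.1
    (hyψ.integrable_mul (hSa.add hSb))
  obtain ⟨i3, j3, k3⟩ := integral_mul_powerIntegral hw hcxm hcx hSm hSpos
    (Y := fun ω => y ω * (ψ (D ω) * (Real.exp (D ω) - 1)))
    (hym.mul (by fun_prop : Measurable fun ω =>
      ψ (D ω) * (Real.exp (D ω) - 1))).aestronglyMeasurable hint3
  have hfactor : ∀ (v : ℂ) (T : ℝ → ℂ), Measurable T →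
      ∫ ω, (y ω : ℂ) * (S ω : ℂ) ^ v * T (D ω) ∂P =
        (∫ ω, (y ω : ℂ) * (S ω : ℂ) ^ v ∂P) * ∫ ω, T (D ω) ∂P := fun v T hT => by
    have hmeas : Measurable[𝓖] fun ω => (y ω : ℂ) * (S ω : ℂ) ^ v :=
      (Complex.measurable_ofReal.comp hy).mul ((Complex.measurable_ofReal.comp hS).pow_const v)
    exact (indepFun_comp_of_indep hind hmeas hT).integral_fun_mul_eq_mul_integral
      (hmeas.mono h𝓖 le_rfl).aestronglyMeasurable (hT.comp hD).aestronglyMeasurable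
  have q1 : ∀ v : ℂ, ∫ ω, ((y ω * ψ (D ω) : ℝ) : ℂ) * (S' ω : ℂ) ^ v ∂P =
      (∫ ω, (y ω : ℂ) * (S ω : ℂ) ^ v ∂P) *
        ∫ ω, (ψ (D ω) : ℂ) * Complex.exp (v * D ω) ∂P := fun v => by
    rw [← hfactor v (fun t => (ψ t : ℂ) * Complex.exp (v * t)) (by fun_prop)]
    congr 1 with ω
    rw [hS', Complex.ofReal_mul (S ω),
      Complex.mul_cpow_ofReal_nonneg (hSpos ω).le (Real.exp_pos _).le,
      ofReal_exp_cpow]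
    push_cast
    ring
  have q2 : ∀ v : ℂ, ∫ ω, ((y ω * ψ (D ω) : ℝ) : ℂ) * (S ω : ℂ) ^ v ∂P =
      (∫ ω, (y ω : ℂ) * (S ω : ℂ) ^ v ∂P) * (∫ ω, ψ (D ω) ∂P : ℝ) := fun v => by
    rw [← integral_complex_ofReal, ← hfactor v (fun t => (ψ t : ℂ)) (by fun_prop)]
    congr 1 with ω
    push_cast
    ring
  have q3 : ∀ v : ℂ, ∫ ω, ((y ω * (ψ (D ω) * (Real.exp (D ω) - 1)) : ℝ) : ℂ) * (S ω : ℂ) ^ v ∂P =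
      (∫ ω, (y ω : ℂ) * (S ω : ℂ) ^ v ∂P) *
        (∫ ω, ψ (D ω) * (Real.exp (D ω) - 1) ∂P : ℝ) := fun v => by
    rw [← integral_complex_ofReal,
      ← hfactor v (fun t => ((ψ t * (Real.exp t - 1) : ℝ) : ℂ)) (by fun_prop)]
    congr 1 with ω
    push_cast
    ring
  simp only [q1] at j1 k1
  simp only [q2] at j2 k2
  simp only [q3] at j3 k3
  have hzero : ∫ ω, (((y ω * ψ (D ω) : ℝ) : ℂ) * powerIntegral μ w c₁ (S' ω)
      - ((y ω * ψ (D ω) : ℝ) : ℂ) * powerIntegral μ w c₀ (S ω)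
      - ((y ω * (ψ (D ω) * (Real.exp (D ω) - 1)) : ℝ) : ℂ) *
        powerIntegral μ w cx (S ω)) ∂P = 0 := by
    rw [integral_sub (by exact i1.sub i2) i3, integral_sub i1 i2, k1, k2, k3, ← integral_sub j1 j2,
      ← integral_sub (by exact j1.sub j2) j3]
    refine integral_eq_zero_of_ae ?_
    filter_upwards [hrel] with v hv
    simp only [Pi.zero_apply]
    linear_combination (∫ ω, (y ω : ℂ) * (S ω : ℂ) ^ v ∂P) * w v * hv
  have hre := Complex.reCLM.integral_comp_comm ((i1.sub i2).sub i3)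
  simp only [Pi.sub_apply] at hre
  rw [hzero, map_zero] at hre
  rw [← hre]
  congr 1 with ω
  simp only [Complex.reCLM_apply, Complex.sub_re, Complex.re_ofReal_mul]
  ring

/-- A function of a complex variable is bounded on the strip `a ≤ Re v ≤ b`. -/
def BoundedOnStrip (a b : ℝ) (f : ℂ → ℂ) : Prop :=
  ∃ C : ℝ, ∀ v : ℂ, a ≤ v.re → v.re ≤ b → ‖f v‖ ≤ C

namespace BoundedOnStrip

variable {a b : ℝ} {f g : ℂ → ℂ}

lemma const (a b : ℝ) (z : ℂ) : BoundedOnStrip a b fun _ => z := ⟨‖z‖, fun _ _ _ => le_rfl⟩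

lemma mul (hf : BoundedOnStrip a b f) (hg : BoundedOnStrip a b g) :
    BoundedOnStrip a b fun v => f v * g v := by
  obtain ⟨C, hC⟩ := hf
  obtain ⟨K, hK⟩ := hg
  refine ⟨C * K, fun v h1 h2 => ?_⟩
  rw [norm_mul]
  exact mul_le_mul (hC v h1 h2) (hK v h1 h2) (norm_nonneg _)
    ((norm_nonneg _).trans (hC v h1 h2))

lemma sub (hf : BoundedOnStrip a b f) (hg : BoundedOnStrip a b g) :
    BoundedOnStrip a b fun v => f v - g v := by
  obtain ⟨C, hC⟩ := hf
  obtain ⟨K, hK⟩ := hg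
  exact ⟨C + K, fun v h1 h2 => (norm_sub_le _ _).trans (add_le_add (hC v h1 h2) (hK v h1 h2))⟩

lemma prod {ι : Type*} (s : Finset ι) {F : ι → ℂ → ℂ} (hF : ∀ i ∈ s, BoundedOnStrip a b (F i)) :
    BoundedOnStrip a b fun v => ∏ i ∈ s, F i v := by
  classical
  induction s using Finset.induction_on with
  | empty => simpa using const a b 1
  | insert i s hi ih =>
    simp only [Finset.prod_insert hi]
    exact (hF i (Finset.mem_insert_self i s)).mul
      (ih fun j hj => hF j (Finset.mem_insert_of_mem hj))

end BoundedOnStrip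

/-- The moment generating function `E[exp(v D)]` at a complex argument. -/
noncomputable def expMoment {Ω : Type*} {m0 : MeasurableSpace Ω} (P : Measure Ω) (D : Ω → ℝ)
    (v : ℂ) : ℂ :=
  ∫ ω, Complex.exp (v * D ω) ∂P

section ExpMoment

variable {Ω : Type*} {m0 : MeasurableSpace Ω} {P : Measure Ω} {D : Ω → ℝ} {a b : ℝ}

lemma measurable_expMoment [SFinite P] (hD : Measurable D) : Measurable (expMoment P D) := by
  have : Measurable fun p : ℂ × Ω => Complex.exp (p.1 * D p.2) := by fun_prop
  exact this.stronglyMeasurable.integral_prod_right.measurable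

lemma norm_cexp_mul_le (t : ℝ) {v : ℂ} (ha : a ≤ v.re) (hb : v.re ≤ b) :
    ‖Complex.exp (v * t)‖ ≤ Real.exp (a * t) + Real.exp (b * t) := by
  have h := rpow_le_rpow_add_rpow (Real.exp_pos t) ha hb
  rw [← Real.exp_mul, ← Real.exp_mul, ← Real.exp_mul] at h
  simpa [Complex.norm_exp, mul_comm t] using h

lemma norm_cexp_add_one_mul_le (t : ℝ) {v : ℂ} (ha : a ≤ v.re) (hb : v.re ≤ b) :
    ‖Complex.exp ((v + 1) * t)‖ ≤ (Real.exp (a * t) + Real.exp (b * t)) * Real.exp t := by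
  have h : ‖Complex.exp (t : ℂ)‖ = Real.exp t := by simp [Complex.norm_exp]
  rw [add_mul, one_mul, Complex.exp_add, norm_mul, h]
  exact mul_le_mul_of_nonneg_right (norm_cexp_mul_le t ha hb) (Real.exp_pos t).le

lemma integrable_cexp [IsFiniteMeasure P]
    (hDa : MemLp (fun ω => Real.exp (a * D ω)) 2 P)
    (hDb : MemLp (fun ω => Real.exp (b * D ω)) 2 P)
    (hD : Measurable D) {v : ℂ} (ha : a ≤ v.re) (hb : v.re ≤ b) :
    Integrable (fun ω => Complex.exp (v * D ω)) P :=
  ((hDa.add hDb).integrable one_le_two).mono'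
    (by fun_prop : Measurable fun ω => Complex.exp (v * D ω)).aestronglyMeasurable
    (.of_forall fun ω => norm_cexp_mul_le (D ω) ha hb)

lemma boundedOnStrip_expMoment [IsFiniteMeasure P]
    (hDa : MemLp (fun ω => Real.exp (a * D ω)) 2 P)
    (hDb : MemLp (fun ω => Real.exp (b * D ω)) 2 P) :
    BoundedOnStrip a b (expMoment P D) :=
  ⟨_, fun _ ha hb => norm_integral_le_of_norm_le ((hDa.add hDb).integrable one_le_two)
    (.of_forall fun ω => norm_cexp_mul_le (D ω) ha hb)⟩

lemma integrable_cexp_add_one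
    (hDa : MemLp (fun ω => Real.exp (a * D ω)) 2 P)
    (hDb : MemLp (fun ω => Real.exp (b * D ω)) 2 P)
    (hD1 : MemLp (fun ω => Real.exp (D ω)) 2 P)
    (hD : Measurable D) {v : ℂ} (ha : a ≤ v.re) (hb : v.re ≤ b) :
    Integrable (fun ω => Complex.exp ((v + 1) * D ω)) P :=
  ((hDa.add hDb).integrable_mul hD1).mono'
    (by fun_prop : Measurable fun ω => Complex.exp ((v + 1) * D ω)).aestronglyMeasurable
    (.of_forall fun ω => norm_cexp_add_one_mul_le (D ω) ha hb)

lemma boundedOnStrip_expMoment_add_one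
    (hDa : MemLp (fun ω => Real.exp (a * D ω)) 2 P)
    (hDb : MemLp (fun ω => Real.exp (b * D ω)) 2 P)
    (hD1 : MemLp (fun ω => Real.exp (D ω)) 2 P) :
    BoundedOnStrip a b fun v => expMoment P D (v + 1) :=
  ⟨_, fun _ ha hb => norm_integral_le_of_norm_le ((hDa.add hDb).integrable_mul hD1)
    (.of_forall fun ω => norm_cexp_add_one_mul_le (D ω) ha hb)⟩

lemma integral_return_mul_cexp [IsFiniteMeasure P]
    (hDa : MemLp (fun ω => Real.exp (a * D ω)) 2 P)
    (hDb : MemLp (fun ω => Real.exp (b * D ω)) 2 P)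
    (hD1 : MemLp (fun ω => Real.exp (D ω)) 2 P)
    (hD : Measurable D) {v : ℂ} (ha : a ≤ v.re) (hb : v.re ≤ b) :
    ∫ ω, ((Real.exp (D ω) - 1 : ℝ) : ℂ) * Complex.exp (v * D ω) ∂P =
      expMoment P D (v + 1) - expMoment P D v := by
  rw [expMoment, expMoment, ← integral_sub (integrable_cexp_add_one hDa hDb hD1 hD ha hb)
    (integrable_cexp hDa hDb hD ha hb)]
  congr 1 with ω
  push_cast
  rw [add_mul, Complex.exp_add, one_mul]
  ring

variable [IsProbabilityMeasure P]

lemma expMoment_one (hD1 : MemLp (fun ω => Real.exp (D ω)) 2 P) :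
    expMoment P D 1 = ((∫ ω, (Real.exp (D ω) - 1) ∂P : ℝ) : ℂ) + 1 := by
  have h : expMoment P D 1 = ((∫ ω, Real.exp (D ω) ∂P : ℝ) : ℂ) := by
    rw [expMoment, ← integral_complex_ofReal]
    simp
  rw [integral_sub (hD1.integrable one_le_two) (integrable_const _), h]
  simp

lemma expMoment_two (hD1 : MemLp (fun ω => Real.exp (D ω)) 2 P) :
    expMoment P D 2 =
    ((∫ ω, (Real.exp (D ω) - 1) ^ 2 ∂P : ℝ) : ℂ)
      + 2 * ((∫ ω, (Real.exp (D ω) - 1) ∂P : ℝ) : ℂ) + 1 := by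
  have h1 : Integrable (fun ω => (Real.exp (D ω) - 1) ^ 2) P :=
    (hD1.sub (memLp_const 1)).integrable_sq
  have h2 : Integrable (fun ω => 2 * (Real.exp (D ω) - 1)) P :=
    ((hD1.integrable one_le_two).sub (integrable_const 1)).const_mul 2
  have h : expMoment P D 2 = ((∫ ω, ((Real.exp (D ω) - 1) ^ 2 + 2 * (Real.exp (D ω) - 1) + 1) ∂P
      : ℝ) : ℂ) := by
    rw [expMoment, ← integral_complex_ofReal]
    congr 1 with ω
    push_cast
    rw [two_mul, Complex.exp_add]
    ring
  rw [h, integral_add (by exact h1.add h2) (integrable_const _), integral_add h1 h2,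
    integral_const_mul]
  simp

/-- A nonconstant return has positive variance. -/
lemma sq_integral_return_lt (hD1 : MemLp (fun ω => Real.exp (D ω)) 2 P)
    (hconst : ¬ ∃ c : ℝ, D =ᵐ[P] fun _ => c) :
    (∫ ω, (Real.exp (D ω) - 1) ∂P) ^ 2 < ∫ ω, (Real.exp (D ω) - 1) ^ 2 ∂P := by
  have hR : MemLp (fun ω => Real.exp (D ω) - 1) 2 P := hD1.sub (memLp_const 1)
  set r := ∫ ω, (Real.exp (D ω) - 1) ∂P with hr
  have hI := (hR.sub (memLp_const r)).integrable_sq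
  have hvar : ∫ ω, (Real.exp (D ω) - 1 - r) ^ 2 ∂P =
      ∫ ω, (Real.exp (D ω) - 1) ^ 2 ∂P - r ^ 2 := by
    have h1 := hR.integrable_sq
    have h2 := (hR.integrable one_le_two).const_mul (2 * r)
    have h3 : ∀ ω, (Real.exp (D ω) - 1 - r) ^ 2 =
        (Real.exp (D ω) - 1) ^ 2 - 2 * r * (Real.exp (D ω) - 1) + r ^ 2 := fun ω => by ring
    simp only [h3]
    rw [integral_add (by exact h1.sub h2) (integrable_const _), integral_sub h1 h2,
      integral_const_mul, ← hr]
    simp only [integral_const, probReal_univ, smul_eq_mul]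
    ring
  rw [← sub_pos, ← hvar]
  refine lt_of_le_of_ne (integral_nonneg fun ω => sq_nonneg _) fun h0 => hconst ?_
  refine ⟨Real.log (1 + r), ?_⟩
  filter_upwards [(integral_eq_zero_iff_of_nonneg (fun ω => sq_nonneg _) hI).1 h0.symm] with ω hω
  have h4 : Real.exp (D ω) - 1 - r = 0 := by simpa using hω
  rw [show 1 + r = Real.exp (D ω) by linarith, Real.log_exp]

end ExpMoment

/-- The hedge ratio coefficient `g(v)` of a single period. -/
noncomputable def hedgeCoeff {Ω : Type*} {m0 : MeasurableSpace Ω} (P : Measure Ω) (D : Ω → ℝ)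
    (v : ℂ) : ℂ :=
  (expMoment P D (v + 1) - expMoment P D 1 * expMoment P D v) /
    (expMoment P D 2 - expMoment P D 1 ^ 2)

/-- The value coefficient `h(v, n)` of the decomposition of the power payoff. -/
noncomputable def valueCoeff {Ω : Type*} {m0 : MeasurableSpace Ω} (P : Measure Ω)
    (D : ℕ → Ω → ℝ) (N n : ℕ) (v : ℂ) : ℂ :=
  ∏ i ∈ Finset.Icc (n + 1) N,
    (expMoment P (D i) v - hedgeCoeff P (D i) v * (expMoment P (D i) 1 - 1))

lemma valueCoeff_eq_mul_succ {Ω : Type*} {m0 : MeasurableSpace Ω} (P : Measure Ω)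
    (D : ℕ → Ω → ℝ) {N n : ℕ} (hn : n < N) (v : ℂ) :
    valueCoeff P D N n v =
      (expMoment P (D (n + 1)) v - hedgeCoeff P (D (n + 1)) v *
        (expMoment P (D (n + 1)) 1 - 1)) * valueCoeff P D N (n + 1) v := by
  rw [valueCoeff, valueCoeff, ← Finset.mul_prod_Ioc_eq_prod_Icc (by omega)]
  have hset : Finset.Ioc (n + 1) N = Finset.Icc (n + 1 + 1) N := by
    ext i
    simp only [Finset.mem_Ioc, Finset.mem_Icc]
    omega
  rw [hset]

lemma measurable_hedgeCoeff {Ω : Type*} {m0 : MeasurableSpace Ω} {P : Measure Ω} [SFinite P]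
    {D : Ω → ℝ} (hD : Measurable D) : Measurable (hedgeCoeff P D) := by
  have := measurable_expMoment (P := P) hD
  unfold hedgeCoeff
  fun_prop

lemma measurable_valueCoeff {Ω : Type*} {m0 : MeasurableSpace Ω} {P : Measure Ω} [SFinite P]
    {D : ℕ → Ω → ℝ} (hD : ∀ n, Measurable (D n)) (N n : ℕ) : Measurable (valueCoeff P D N n) :=
  Finset.measurable_fun_prod _ fun i _ => (measurable_expMoment (hD i)).sub
    ((measurable_hedgeCoeff (hD i)).mul_const _)

lemma boundedOnStrip_hedgeCoeff {Ω : Type*} {m0 : MeasurableSpace Ω} {P : Measure Ω}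
    [IsProbabilityMeasure P] {D : Ω → ℝ} {a b : ℝ}
    (hDa : MemLp (fun ω => Real.exp (a * D ω)) 2 P)
    (hDb : MemLp (fun ω => Real.exp (b * D ω)) 2 P)
    (hD1 : MemLp (fun ω => Real.exp (D ω)) 2 P) : BoundedOnStrip a b (hedgeCoeff P D) := by
  simp only [funext (hedgeCoeff.eq_1 P D), div_eq_mul_inv]
  exact ((boundedOnStrip_expMoment_add_one hDa hDb hD1).sub
    ((BoundedOnStrip.const a b _).mul (boundedOnStrip_expMoment hDa hDb))).mul
      (BoundedOnStrip.const a b _)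

lemma boundedOnStrip_valueCoeff {Ω : Type*} {m0 : MeasurableSpace Ω} {P : Measure Ω}
    [IsProbabilityMeasure P] {D : ℕ → Ω → ℝ} {a b : ℝ} {N : ℕ}
    (hDa : ∀ n < N, MemLp (fun ω => Real.exp (a * D (n + 1) ω)) 2 P)
    (hDb : ∀ n < N, MemLp (fun ω => Real.exp (b * D (n + 1) ω)) 2 P)
    (hD1 : ∀ n < N, MemLp (fun ω => Real.exp (D (n + 1) ω)) 2 P) (n : ℕ) :
    BoundedOnStrip a b (valueCoeff P D N n) := by
  refine BoundedOnStrip.prod _ fun i hi => ?_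
  obtain ⟨j, rfl⟩ : ∃ j, i = j + 1 := ⟨i - 1, by grind⟩
  have hj : j < N := by grind
  exact (boundedOnStrip_expMoment (hDa j hj) (hDb j hj)).sub
    ((boundedOnStrip_hedgeCoeff (hDa j hj) (hDb j hj) (hD1 j hj)).mul
      (BoundedOnStrip.const a b _))

/-- The superposed power decomposition is a residual decomposition. -/
theorem isResidualDecomposition_powerIntegral {Ω : Type*} {m0 : MeasurableSpace Ω}
    {P : Measure Ω} [IsProbabilityMeasure P] {𝓕 : Filtration ℕ m0} {N : ℕ} {D S : ℕ → Ω → ℝ}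
    {μ : Measure ℂ} [SFinite μ] {w : ℂ → ℂ} {a b : ℝ} (hw : Integrable w μ)
    (hstrip : ∀ᵐ v ∂μ, a ≤ v.re ∧ v.re ≤ b)
    (hDm : ∀ n, Measurable (D n)) (hDad : ∀ n < N, Measurable[𝓕 (n + 1)] (D (n + 1)))
    (hind : ∀ n < N, Indep (𝓕 n) (MeasurableSpace.comap (D (n + 1)) inferInstance) P)
    (hconst : ∀ n < N, ¬ ∃ c : ℝ, D (n + 1) =ᵐ[P] fun _ => c)
    (hSm : ∀ n, Measurable[𝓕 n] (S n)) (hSpos : ∀ n ω, 0 < S n ω)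
    (hSsucc : ∀ n ω, S (n + 1) ω = S n ω * Real.exp (D (n + 1) ω))
    (hSa : ∀ n ≤ N, MemLp (fun ω => S n ω ^ a) 2 P)
    (hSb : ∀ n ≤ N, MemLp (fun ω => S n ω ^ b) 2 P)
    (hDa : ∀ n < N, MemLp (fun ω => Real.exp (a * D (n + 1) ω)) 2 P)
    (hDb : ∀ n < N, MemLp (fun ω => Real.exp (b * D (n + 1) ω)) 2 P)
    (hD1 : ∀ n < N, MemLp (fun ω => Real.exp (D (n + 1) ω)) 2 P) :
    IsResidualDecomposition P 𝓕 N (fun n ω => Real.exp (D n ω) - 1)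
      (fun n ω => (powerIntegral μ w (valueCoeff P D N n) (S n ω)).re)
      (fun n ω => (powerIntegral μ w (fun v => hedgeCoeff P (D n) v * valueCoeff P D N n v)
        (S (n - 1) ω)).re) := by
  have hSm' : ∀ n, Measurable (S n) := fun n => (hSm n).mono (𝓕.le n) le_rfl
  have hvm := measurable_valueCoeff (P := P) hDm N
  have hxm : ∀ n, Measurable fun v => hedgeCoeff P (D n) v * valueCoeff P D N n v := fun n =>
    (measurable_hedgeCoeff (hDm n)).mul (hvm n)
  have hbound : ∀ {c : ℂ → ℂ}, BoundedOnStrip a b c →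
      ∃ C, ∀ᵐ v ∂μ, a ≤ v.re ∧ v.re ≤ b ∧ ‖c v‖ ≤ C := by
    rintro c ⟨C, hC⟩
    refine ⟨C, ?_⟩
    filter_upwards [hstrip] with v hv using ⟨hv.1, hv.2, hC v hv.1 hv.2⟩
  have hvb : ∀ n, ∃ C, ∀ᵐ v ∂μ, a ≤ v.re ∧ v.re ≤ b ∧ ‖valueCoeff P D N n v‖ ≤ C := fun n =>
    hbound (boundedOnStrip_valueCoeff hDa hDb hD1 n)
  have hxb : ∀ n < N, ∃ C, ∀ᵐ v ∂μ, a ≤ v.re ∧ v.re ≤ b ∧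
      ‖hedgeCoeff P (D (n + 1)) v * valueCoeff P D N (n + 1) v‖ ≤ C := fun n hn =>
    hbound ((boundedOnStrip_hedgeCoeff (hDa n hn) (hDb n hn) (hD1 n hn)).mul
      (boundedOnStrip_valueCoeff hDa hDb hD1 (n + 1)))
  have hR : ∀ n < N, MemLp (fun ω => Real.exp (D (n + 1) ω) - 1) 2 P := fun n hn =>
    (hD1 n hn).sub (memLp_const 1)
  have hretm : Measurable fun t : ℝ => Real.exp t - 1 := by fun_prop
  have hFm : ∀ {c : ℂ → ℂ}, Measurable c → Measurable fun s => (powerIntegral μ w c s).re :=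
    fun hc => Complex.measurable_re.comp (measurable_powerIntegral hw.1 hc)
  refine
    { measG := fun n _ => ((hFm (hvm n)).comp (hSm n)).stronglyMeasurable
      memG := fun n hn => ?_
      measx := fun n _ => ((hFm (hxm (n + 1))).comp (hSm n)).stronglyMeasurable
      memx := fun n hn => ?_
      measR := fun n hn => (hretm.comp (hDad n hn)).stronglyMeasurable
      memR := hR
      indepR := fun n hn => ?_
      variance_pos := fun n hn => sq_integral_return_lt (hD1 n hn) (hconst n hn)
      orthogonal := fun n hn y hy hyL => ?_ }
  · obtain ⟨C, hC⟩ := hvb n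
    exact memLp_re_powerIntegral hw (hvm n) hC (hSm' n) (hSpos n) (hSa n hn) (hSb n hn)
  · obtain ⟨C, hC⟩ := hxb n hn
    exact memLp_re_powerIntegral hw (hxm (n + 1)) hC (hSm' n) (hSpos n) (hSa n hn.le)
      (hSb n hn.le)
  · refine indep_of_indep_of_le_right (hind n hn) ?_
    rintro _ ⟨s, hs, rfl⟩
    exact ⟨(fun t => Real.exp t - 1) ⁻¹' s, hretm hs, rfl⟩
  · obtain ⟨C₁, hC₁⟩ := hvb (n + 1)
    obtain ⟨C₀, hC₀⟩ := hvb n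
    obtain ⟨Cx, hCx⟩ := hxb n hn
    have horth : ∀ ψ : ℝ → ℝ, Measurable ψ → MemLp (fun ω => ψ (D (n + 1) ω)) 2 P → _ →
        _ := fun ψ hψ hψL hrel =>
      integral_mul_residual_eq_zero (𝓕.le n) (hDm (n + 1)) (hind n hn) hw (hvm (n + 1)) hC₁
        (hvm n) hC₀ (hxm (n + 1)) hCx (hSm n) (hSpos n) (hSsucc n) (hSa n hn.le) (hSb n hn.le)
        (hSa (n + 1) hn) (hSb (n + 1) hn) (hR n hn) hy.measurable hyL hψ hψL hrel
    have hm1 := expMoment_one (hD1 n hn)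
    have hm2 := expMoment_two (hD1 n hn)
    refine ⟨?_, horth (fun t => Real.exp t - 1) hretm (hR n hn) ?_⟩
    · have h := horth (fun _ => 1) measurable_const (memLp_const 1) ?_
      · simpa using h
      · refine .of_forall fun v => ?_
        have hint : ∫ ω, ((1 : ℝ) : ℂ) * Complex.exp (v * D (n + 1) ω) ∂P =
            expMoment P (D (n + 1)) v := by simp [expMoment]
        rw [hint, valueCoeff_eq_mul_succ P D hn, hm1]
        simp only [integral_const, probReal_univ, smul_eq_mul, one_mul, Complex.ofReal_one]
        ring
    · filter_upwards [hstrip] with v hv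
      rw [integral_return_mul_cexp (hDa n hn) (hDb n hn) (hD1 n hn) (hDm (n + 1)) hv.1 hv.2,
        valueCoeff_eq_mul_succ P D hn]
      have hne : expMoment P (D (n + 1)) 2 - expMoment P (D (n + 1)) 1 ^ 2 ≠ 0 := by
        rw [hm1, hm2]
        have hvar := sq_integral_return_lt (hD1 n hn) (hconst n hn)
        intro h0
        refine (sub_pos.2 hvar).ne' ?_
        have h1 : ((∫ ω, (Real.exp (D (n + 1) ω) - 1) ^ 2 ∂P -
            (∫ ω, (Real.exp (D (n + 1) ω) - 1) ∂P) ^ 2 : ℝ) : ℂ) = 0 := by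
          rw [← h0]
          push_cast
          ring
        exact_mod_cast h1
      have hg : hedgeCoeff P (D (n + 1)) v *
          (expMoment P (D (n + 1)) 2 - expMoment P (D (n + 1)) 1 ^ 2) =
          expMoment P (D (n + 1)) (v + 1) -
            expMoment P (D (n + 1)) 1 * expMoment P (D (n + 1)) v := div_mul_cancel₀ _ hne
      rw [hm1, hm2] at hg
      rw [hm1]
      simp only [← pow_two]
      linear_combination (-valueCoeff P D N (n + 1) v) * hg

/-- Exponential moments of a process with independent increments pass to earlier times and to
the increments. -/
lemma integrable_exp_mul_of_terminal {Ω : Type*} {m0 : MeasurableSpace Ω} {P : Measure Ω}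
    [IsProbabilityMeasure P] {𝓕 : Filtration ℕ m0} {N : ℕ} {X D : ℕ → Ω → ℝ}
    (hX : ∀ n, Measurable[𝓕 n] (X n)) (hD : ∀ n ω, D (n + 1) ω = X (n + 1) ω - X n ω)
    (hind : ∀ n < N, Indep (𝓕 n) (MeasurableSpace.comap (D (n + 1)) inferInstance) P)
    {t : ℝ} (ht : Integrable (fun ω => Real.exp (t * X N ω)) P) :
    (∀ n ≤ N, Integrable (fun ω => Real.exp (t * X n ω)) P) ∧
      ∀ n < N, Integrable (fun ω => Real.exp (t * D (n + 1) ω)) P := by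
  have hXm : ∀ n, Measurable (X n) := fun n => (hX n).mono (𝓕.le n) le_rfl
  have hDm : ∀ n, Measurable (D (n + 1)) := fun n => by
    rw [funext (hD n)]
    exact (hXm _).sub (hXm _)
  have hne : ∀ Y : Ω → ℝ, ¬ (fun ω => Real.exp (t * Y ω)) =ᵐ[P] 0 := fun Y h => by
    obtain ⟨ω, hω⟩ := h.exists
    exact (Real.exp_pos _).ne' hω
  have hstep : ∀ n < N, Integrable (fun ω => Real.exp (t * X (n + 1) ω)) P →
      Integrable (fun ω => Real.exp (t * X n ω)) P ∧
        Integrable (fun ω => Real.exp (t * D (n + 1) ω)) P := fun n hn hint => by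
    have hexpm : Measurable fun s : ℝ => Real.exp (t * s) := by fun_prop
    have hi : IndepFun (fun ω => Real.exp (t * X n ω)) (fun ω => Real.exp (t * D (n + 1) ω)) P :=
      indepFun_comp_of_indep (hind n hn) (hexpm.comp (hX n)) hexpm
    have hmul : Integrable (fun ω => Real.exp (t * X n ω) * Real.exp (t * D (n + 1) ω)) P := by
      refine hint.congr (.of_forall fun ω => ?_)
      simp only [hD n ω, ← Real.exp_add]
      ring_nf
    exact ⟨hi.integrable_left_of_integrable_op (· * ·) 1 one_ne_zero
        (fun x y => by simp [enorm_mul]) hmul (hexpm.comp (hXm n)).aestronglyMeasurable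
        (hexpm.comp (hDm n)).aestronglyMeasurable (hne _),
      hi.integrable_right_of_integrable_op (· * ·) 1 one_ne_zero
        (fun x y => by simp [enorm_mul]) hmul (hexpm.comp (hXm n)).aestronglyMeasurable
        (hexpm.comp (hDm n)).aestronglyMeasurable (hne _)⟩
  have hall : ∀ n ≤ N, Integrable (fun ω => Real.exp (t * X n ω)) P := fun n hn =>
    Nat.decreasingInduction (motive := fun k _ => Integrable (fun ω => Real.exp (t * X k ω)) P)
      (fun k hk ih => (hstep k hk ih).1) ht hn
  exact ⟨hall, fun n hn => (hstep n hn (hall (n + 1) hn)).2⟩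

lemma memLp_two_exp_mul {Ω : Type*} {m0 : MeasurableSpace Ω} {P : Measure Ω} {Y : Ω → ℝ}
    (hY : Measurable Y) {t : ℝ} (h : Integrable (fun ω => Real.exp (2 * t * Y ω)) P) :
    MemLp (fun ω => Real.exp (t * Y ω)) 2 P := by
  have hm : Measurable fun ω => Real.exp (t * Y ω) := by fun_prop
  refine (memLp_two_iff_integrable_sq hm.aestronglyMeasurable).2
    (h.congr (.of_forall fun ω => ?_))
  simp only [pow_two, ← Real.exp_add]
  ring_nf

/-- Solution of the discrete mean-variance hedging problem.  Under
Assumptions A and B, let `H = f(S_N)` with real discrete FS decomposition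
`H = H₀ + Σ_{k=1}^N ξ^H_k ΔS_k + L^H_N` (obtained by integrating the explicit power-payoff
decomposition against `Π`) and intermediate value process
`H_n = H₀ + Σ_{k=1}^n ξ^H_k ΔS_k + L^H_n`.  Then the minimization of
`E[(H − V₀ − Σ_{k=1}^N v_k ΔS_k)²]` over `V₀ ∈ ℝ` and `v ∈ Θ` is solved by `V₀* = H₀` and the
strategy `φ*` determined recursively by
`φ*_n = ξ^H_n + λ_n (H_{n−1} − H₀ − Σ_{i<n} φ*_i ΔS_i)` with
`λ_n = (1/S_{n−1}) (m(1,n) − 1)/(m(2,n) − 2m(1,n) + 1)`; moreover this solution is unique up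
to a null set. -/
theorem stmt_11 {Ω : Type*} {m0 : MeasurableSpace Ω} (P : Measure Ω) [IsProbabilityMeasure P]
    (N : ℕ) (hN : 1 ≤ N) (𝓕 : Filtration ℕ m0)
    (h𝓕0 : ∀ A : Set Ω, MeasurableSet[𝓕 0] A → P A = 0 ∨ P A = 1)
    (X : ℕ → Ω → ℝ) (hXmeas : ∀ n, Measurable (X n)) (hX0 : ∀ ω, X 0 ω = 0)
    (hXadapted : StronglyAdapted 𝓕 X)
    (hindep : iIndepFun (m := fun _ : Fin N => inferInstance)
      (fun (k : Fin N) (ω : Ω) => X (k.val + 1) ω - X k.val ω) P)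
    (hindep𝓕 : ∀ n, 1 ≤ n → n ≤ N →
      Indep (𝓕 (n - 1))
        (MeasurableSpace.comap (fun ω => X n ω - X (n - 1) ω) inferInstance) P)
    (s0 : ℝ) (hs0 : 0 < s0)
    (S : ℕ → Ω → ℝ) (hS : ∀ n ω, S n ω = s0 * Real.exp (X n ω))
    (D : Set ℂ)
    (hD : D = {w : ℂ | Integrable (fun ω => Complex.exp (w * X N ω)) P})
    -- Assumption A
    (hA1 : ∀ n, 1 ≤ n → n ≤ N →
      ¬ ∃ c : ℝ, (fun ω => X n ω - X (n - 1) ω) =ᵐ[P] fun _ => c)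
    (hA2 : (2 : ℂ) ∈ D)
    -- the finite complex measure Π(dz) = w(z) μ(dz) and Assumption B
    (μ : Measure ℂ) [IsFiniteMeasure μ] (w : ℂ → ℂ) (hw : Integrable w μ)
    (I₀ : Set ℝ) (hI₀ : IsCompact I₀)
    (h2I₀ : ∀ x ∈ I₀, ((2 * x : ℝ) : ℂ) ∈ D)
    (hconc : ∀ᵐ z ∂μ, z.re ∈ I₀)
    (hreal : ∀ s : ℝ, 0 < s → (∫ v, (s : ℂ) ^ v * w v ∂μ).im = 0)
    -- the decomposition ingredients (with the vanishing convention)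
    (m : ℂ → ℕ → ℂ)
    (hm : ∀ v n, m v n = ∫ ω, Complex.exp (v * (X n ω - X (n - 1) ω)) ∂P)
    (g : ℂ → ℕ → ℂ)
    (hg : ∀ v n, ((2 * v.re : ℝ) : ℂ) ∈ D →
      g v n = (m (v + 1) n - m 1 n * m v n) / (m 2 n - (m 1 n) ^ 2))
    (hg0 : ∀ v n, ((2 * v.re : ℝ) : ℂ) ∉ D → g v n = 0)
    (h : ℂ → ℕ → ℂ)
    (hh : ∀ v n, ((2 * v.re : ℝ) : ℂ) ∈ D →
      h v n = ∏ i ∈ Finset.Icc (n + 1) N, (m v i - g v i * (m 1 i - 1)))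
    (hh0 : ∀ v n, ((2 * v.re : ℝ) : ℂ) ∉ D → h v n = 0)
    (Hz : ℂ → ℕ → Ω → ℂ)
    (hHz : ∀ v n ω, ((2 * v.re : ℝ) : ℂ) ∈ D → Hz v n ω = h v n * (S n ω : ℂ) ^ v)
    (hHz0 : ∀ v n ω, ((2 * v.re : ℝ) : ℂ) ∉ D → Hz v n ω = 0)
    (ξz : ℂ → ℕ → Ω → ℂ)
    (hξz : ∀ v n ω, ((2 * v.re : ℝ) : ℂ) ∈ D →
      ξz v n ω = g v n * h v n * (S (n - 1) ω : ℂ) ^ (v - 1))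
    (hξz0 : ∀ v n ω, ((2 * v.re : ℝ) : ℂ) ∉ D → ξz v n ω = 0)
    (Lz : ℂ → ℕ → Ω → ℂ)
    (hLz : ∀ v n ω, Lz v n ω = Hz v n ω - Hz v 0 ω -
        ∑ k ∈ Finset.Icc 1 n, ξz v k ω * ((S k ω : ℂ) - (S (k - 1) ω : ℂ)))
    -- the real-valued integrated processes and payoff
    (H : Ω → ℝ) (hH : ∀ ω, H ω = (∫ v, (S N ω : ℂ) ^ v * w v ∂μ).re)
    (Hn : ℕ → Ω → ℝ) (hHn : ∀ n ω, Hn n ω = (∫ v, Hz v n ω * w v ∂μ).re)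
    (ξH : ℕ → Ω → ℝ) (hξH : ∀ n ω, ξH n ω = (∫ v, ξz v n ω * w v ∂μ).re)
    (V0star : ℝ) (hV0star : ∀ ω, V0star = Hn 0 ω)
    -- λ and the recursively defined optimal strategy
    (lam : ℕ → Ω → ℝ)
    (hlam : ∀ n ω, lam n ω =
      (1 / S (n - 1) ω) * ((m 1 n - 1) / (m 2 n - 2 * m 1 n + 1)).re)
    (φ : ℕ → Ω → ℝ)
    (hφ : ∀ n, 1 ≤ n → n ≤ N → ∀ ω, φ n ω =
      ξH n ω + lam n ω *
        (Hn (n - 1) ω - V0star -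
          ∑ i ∈ Finset.Icc 1 (n - 1), φ i ω * (S i ω - S (i - 1) ω))) :
    -- optimality of (V₀*, φ*)
    (∀ V0 : ℝ, ∀ v : ℕ → Ω → ℝ,
        (∀ k, 1 ≤ k → k ≤ N → StronglyMeasurable[𝓕 (k - 1)] (v k)) →
        (∀ k, 1 ≤ k → k ≤ N →
          MemLp (fun ω => v k ω * (S k ω - S (k - 1) ω)) 2 P) →
        ∫ ω, (H ω - V0star -
            ∑ k ∈ Finset.Icc 1 N, φ k ω * (S k ω - S (k - 1) ω)) ^ 2 ∂P
          ≤ ∫ ω, (H ω - V0 -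
              ∑ k ∈ Finset.Icc 1 N, v k ω * (S k ω - S (k - 1) ω)) ^ 2 ∂P)
    -- uniqueness (up to a null set)
    ∧ (∀ V0 : ℝ, ∀ v : ℕ → Ω → ℝ,
        (∀ k, 1 ≤ k → k ≤ N → StronglyMeasurable[𝓕 (k - 1)] (v k)) →
        (∀ k, 1 ≤ k → k ≤ N →
          MemLp (fun ω => v k ω * (S k ω - S (k - 1) ω)) 2 P) →
        (∫ ω, (H ω - V0 -
            ∑ k ∈ Finset.Icc 1 N, v k ω * (S k ω - S (k - 1) ω)) ^ 2 ∂P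
          = ∫ ω, (H ω - V0star -
              ∑ k ∈ Finset.Icc 1 N, φ k ω * (S k ω - S (k - 1) ω)) ^ 2 ∂P) →
        V0 = V0star ∧ ∀ k, 1 ≤ k → k ≤ N → v k =ᵐ[P] φ k) := by
  have hDn : ∀ n ω, X (n + 1) ω - X (n + 1 - 1) ω = X (n + 1) ω - X n ω := fun n ω => rfl
  set Δ : ℕ → Ω → ℝ := fun n ω => X n ω - X (n - 1) ω with hΔ
  have hΔm : ∀ n, Measurable (Δ n) := fun n => (hXmeas n).sub (hXmeas (n - 1))
  have hXad : ∀ n, Measurable[𝓕 n] (X n) := fun n => (hXadapted n).measurable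
  have hΔad : ∀ n < N, Measurable[𝓕 (n + 1)] (Δ (n + 1)) := fun n _ =>
    (hXad (n + 1)).sub ((hXad n).mono (𝓕.mono (Nat.le_succ n)) le_rfl)
  have hind : ∀ n < N, Indep (𝓕 n) (MeasurableSpace.comap (Δ (n + 1)) inferInstance) P :=
    fun n hn => hindep𝓕 (n + 1) (by omega) hn
  have hconst : ∀ n < N, ¬ ∃ c : ℝ, Δ (n + 1) =ᵐ[P] fun _ => c :=
    fun n hn => hA1 (n + 1) (by omega) hn
  have hSpos : ∀ n ω, 0 < S n ω := fun n ω => by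
    rw [hS]
    exact mul_pos hs0 (Real.exp_pos _)
  have hSad : ∀ n, Measurable[𝓕 n] (S n) := fun n => by
    rw [funext (hS n)]
    exact (Real.measurable_exp.comp (hXad n)).const_mul s0
  have hSsucc : ∀ n ω, S (n + 1) ω = S n ω * Real.exp (Δ (n + 1) ω) := fun n ω => by
    rw [hS, hS, mul_assoc, ← Real.exp_add]
    simp [hΔ]
  have hDreal : ∀ x : ℝ, ((2 * x : ℝ) : ℂ) ∈ D → Integrable (fun ω => Real.exp (2 * x * X N ω)) P :=
    fun x hx => by
      rw [hD] at hx
      refine hx.norm.congr (.of_forall fun ω => ?_)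
      simp [Complex.norm_exp]
  -- endpoints of a strip carrying the measure
  obtain ⟨a, b, ha, hb, hab⟩ : ∃ a b : ℝ, ((2 * a : ℝ) : ℂ) ∈ D ∧ ((2 * b : ℝ) : ℂ) ∈ D ∧
      ∀ x ∈ I₀, a ≤ x ∧ x ≤ b := by
    rcases I₀.eq_empty_or_nonempty with rfl | hne
    · exact ⟨1, 1, by simpa using hA2, by simpa using hA2, by simp⟩
    · obtain ⟨a, ha, ha'⟩ := hI₀.exists_isLeast hne
      obtain ⟨b, hb, hb'⟩ := hI₀.exists_isGreatest hne
      exact ⟨a, b, h2I₀ a ha, h2I₀ b hb, fun x hx => ⟨ha' hx, hb' hx⟩⟩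
  have hstrip : ∀ᵐ v ∂μ, a ≤ v.re ∧ v.re ≤ b := hconc.mono fun v hv => hab _ hv
  have hmom : ∀ x : ℝ, ((2 * x : ℝ) : ℂ) ∈ D →
      (∀ n ≤ N, MemLp (fun ω => S n ω ^ x) 2 P) ∧
        ∀ n < N, MemLp (fun ω => Real.exp (x * Δ (n + 1) ω)) 2 P := fun x hx => by
    obtain ⟨h1, h2⟩ := integrable_exp_mul_of_terminal (D := Δ) hXad hDn hind (hDreal x hx)
    refine ⟨fun n hn => ?_, fun n hn => memLp_two_exp_mul (hΔm _) (h2 n hn)⟩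
    have h3 : ∀ ω, S n ω ^ x = s0 ^ x * Real.exp (x * X n ω) := fun ω => by
      rw [hS, Real.mul_rpow hs0.le (Real.exp_pos _).le, ← Real.exp_mul, mul_comm x]
    rw [funext h3]
    exact (memLp_two_exp_mul (hXmeas n) (h1 n hn)).const_mul _
  have hD1 : ∀ n < N, MemLp (fun ω => Real.exp (Δ (n + 1) ω)) 2 P := fun n hn => by
    simpa using (hmom 1 (by simpa using hA2)).2 n hn
  have hM := isResidualDecomposition_powerIntegral (S := S) hw hstrip hΔm hΔad hind hconst hSad
    hSpos hSsucc (hmom a ha).1 (hmom b hb).1 (hmom a ha).2 (hmom b hb).2 hD1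
  set R : ℕ → Ω → ℝ := fun n ω => Real.exp (Δ n ω) - 1 with hR
  set G : ℕ → Ω → ℝ := fun n ω => (powerIntegral μ w (valueCoeff P Δ N n) (S n ω)).re with hG
  set x : ℕ → Ω → ℝ := fun n ω => (powerIntegral μ w
    (fun v => hedgeCoeff P (Δ n) v * valueCoeff P Δ N n v) (S (n - 1) ω)).re with hx
  -- identification of the given processes
  have hmM : ∀ v n, m v n = expMoment P (Δ n) v := fun v n => by
    rw [hm, expMoment]
    simp [hΔ]
  have hgg : ∀ v n, ((2 * v.re : ℝ) : ℂ) ∈ D → g v n = hedgeCoeff P (Δ n) v := fun v n hv => by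
    rw [hg v n hv, hedgeCoeff]
    simp only [hmM]
  have hhh : ∀ v n, ((2 * v.re : ℝ) : ℂ) ∈ D → h v n = valueCoeff P Δ N n v := fun v n hv => by
    rw [hh v n hv, valueCoeff]
    simp only [hmM, hgg v _ hv]
  have hHnG : ∀ n ω, Hn n ω = G n ω := fun n ω => by
    rw [hHn, hG]
    congr 1
    refine integral_congr_ae ?_
    filter_upwards [hconc] with v hv
    rw [hHz v n ω (h2I₀ _ hv), hhh v n (h2I₀ _ hv)]
  have hξx : ∀ n ω, ξH n ω * S (n - 1) ω = x n ω := fun n ω => by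
    rw [hξH, hx, ← Complex.re_mul_ofReal, ← integral_mul_const]
    congr 1
    refine integral_congr_ae ?_
    filter_upwards [hconc] with v hv
    have hne : (S (n - 1) ω : ℂ) ≠ 0 := by exact_mod_cast (hSpos (n - 1) ω).ne'
    rw [hξz v n ω (h2I₀ _ hv), hgg v n (h2I₀ _ hv), hhh v n (h2I₀ _ hv),
      Complex.cpow_sub _ _ hne, Complex.cpow_one]
    field_simp
  have hHG : ∀ ω, H ω = G N ω := fun ω => by
    rw [hH, hG]
    simp [powerIntegral, valueCoeff]
  have hΔS : ∀ k, 1 ≤ k → ∀ ω, S k ω - S (k - 1) ω = S (k - 1) ω * R k ω := fun k hk ω => by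
    obtain ⟨j, rfl⟩ : ∃ j, k = j + 1 := ⟨k - 1, by omega⟩
    rw [hSsucc, hR]
    simp only [Nat.add_sub_cancel]
    ring
  have herr : ∀ (V : ℝ) (v : ℕ → Ω → ℝ) (n : ℕ) (ω : Ω),
      G n ω - V - ∑ k ∈ Finset.Icc 1 n, v k ω * (S k ω - S (k - 1) ω) =
        hedgingError R G V (fun k ω => v k ω * S (k - 1) ω) n ω := fun V v n ω => by
    rw [hedgingError]
    congr 1
    refine Finset.sum_congr rfl fun k hk => ?_
    rw [hΔS k (Finset.mem_Icc.1 hk).1, mul_assoc]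
  have hlamR : ∀ n < N, ((m 1 (n + 1) - 1) / (m 2 (n + 1) - 2 * m 1 (n + 1) + 1)).re =
      (∫ ω, R (n + 1) ω ∂P) / ∫ ω, R (n + 1) ω ^ 2 ∂P := fun n hn => by
    rw [hmM, hmM, expMoment_one (hD1 n hn), expMoment_two (hD1 n hn), ← Complex.ofReal_re
      ((∫ ω, R (n + 1) ω ∂P) / ∫ ω, R (n + 1) ω ^ 2 ∂P), Complex.ofReal_div]
    congr 2 <;> ring
  have hψ : ∀ n < N, ∀ ω, φ (n + 1) ω * S (n + 1 - 1) ω = x (n + 1) ω +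
      (∫ ω, R (n + 1) ω ∂P) / (∫ ω, R (n + 1) ω ^ 2 ∂P) *
        hedgingError R G V0star (fun k ω => φ k ω * S (k - 1) ω) n ω := fun n hn ω => by
    rw [hφ (n + 1) (by omega) hn, hlam, hlamR n hn, ← hξx, ← herr, ← hHnG, Nat.add_sub_cancel]
    have := (hSpos n ω).ne'
    field_simp
  have hadm : ∀ v : ℕ → Ω → ℝ,
      (∀ k, 1 ≤ k → k ≤ N → StronglyMeasurable[𝓕 (k - 1)] (v k)) →
      (∀ k, 1 ≤ k → k ≤ N → MemLp (fun ω => v k ω * (S k ω - S (k - 1) ω)) 2 P) →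
      (∀ k < N, StronglyMeasurable[𝓕 k] fun ω => v (k + 1) ω * S (k + 1 - 1) ω) ∧
        ∀ k < N, MemLp (fun ω => v (k + 1) ω * S (k + 1 - 1) ω) 2 P := fun v hv hvL => by
    have hmeas : ∀ k < N, StronglyMeasurable[𝓕 k] fun ω => v (k + 1) ω * S (k + 1 - 1) ω :=
      fun k hk => (hv (k + 1) (by omega) hk).mul (hSad k).stronglyMeasurable
    refine ⟨hmeas, fun k hk => ?_⟩
    refine memLp_two_of_mul_of_indep (hM.indepFun hk (hmeas k hk).measurable)
      ((hmeas k hk).mono (𝓕.le k)).aestronglyMeasurable (hM.memR k hk) (hM.integral_sq_pos hk) ?_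
    have h1 := hvL (k + 1) (by omega) hk
    simp only [hΔS (k + 1) (by omega), ← mul_assoc] at h1
    exact h1
  have hopt : ∀ (V : ℝ) (v : ℕ → Ω → ℝ), _ → _ → _ := fun V v hv hvL =>
    hM.feedback_optimal (ψ := fun k ω => φ k ω * S (k - 1) ω)
      (u := fun k ω => v k ω * S (k - 1) ω)
      (fun ω => by rw [← hHnG, ← hV0star ω]) hψ V (hadm v hv hvL).1 (hadm v hv hvL).2 N le_rfl
  simp only [hHG, herr]
  refine ⟨fun V v hv hvL => (hopt V v hv hvL).1, fun V v hv hvL heq => ?_⟩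
  obtain ⟨hV, hk⟩ := (hopt V v hv hvL).2 heq
  refine ⟨hV, fun k hk1 hkN => ?_⟩
  obtain ⟨j, rfl⟩ : ∃ j, k = j + 1 := ⟨k - 1, by omega⟩
  filter_upwards [hk j hkN] with ω hω
  exact mul_right_cancel₀ (hSpos (j + 1 - 1) ω).ne' hω
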